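/- The intertwining operators generate the whole family of nonsymmetric Macdonald polynomials: for every n ≥ 0, E_{n+1} = q^{n/2}·X·π(E_{−n}), and for every n ≥ 1, E_{−n} = t^{1/2}·( T(E_n) + ((t^{1/2} − t^{-1/2})/(qⁿ·t − 1))·E_n ). -/

import Mathlib

/-!
Nonsymmetric Macdonald polynomials of type A₁: the explicit Laurent polynomials `E n`
are eigenfunctions of the Dunkl-type operator `Y` with eigenvalue `q^{-n_#}`.

The ground field is `F = ℚ(u,v)` with `q = u⁴`, `t = v²`; the Laurent polynomials
`F[X, X⁻¹]` are regarded inside the ambient field `M = F(X)`, in which all operators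
are given by the same formulas (division by `X² - 1` is then unproblematic).
-/

noncomputable section

/-- The ground field `ℚ(u,v)`. -/
abbrev F : Type := RatFunc (RatFunc ℚ)

/-- `u`, with `q = u⁴` (so `u = q^{1/4}`). -/
def u : F := RatFunc.C RatFunc.X

/-- `v`, with `t = v²` (so `v = t^{1/2}`). -/
def v : F := RatFunc.X

/-- `q = u⁴`. -/
def q : F := u ^ 4

/-- `t = v²`. -/
def t : F := v ^ 2

/-- The ambient field `F(X)` containing the Laurent polynomials `F[X,X⁻¹]`. -/
abbrev M : Type := RatFunc F

/-- The variable `X`. -/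
def XM : M := RatFunc.X

/-- The involution `s : Xⁿ ↦ X⁻ⁿ` (the substitution `X ↦ X⁻¹`). -/
def sOp : M → M := RatFunc.eval RatFunc.C (XM⁻¹)

/-- The operator `π : Xⁿ ↦ q^{n/2} X⁻ⁿ` (the substitution `X ↦ q^{1/2} X⁻¹`). -/
def piOp : M → M := RatFunc.eval RatFunc.C (RatFunc.C (u ^ 2) * XM⁻¹)

/-- The Demazure-Lusztig operator
`T(f) = t^{1/2}·s(f) + (t^{1/2} - t^{-1/2})·(s(f) - f)/(X² - 1)`. -/
def TOp (f : M) : M :=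
  RatFunc.C v * sOp f + RatFunc.C (v - v⁻¹) * (sOp f - f) / (XM ^ 2 - 1)

/-- The operator `Y = π ∘ T`. -/
def YOp (f : M) : M := piOp (TOp f)

/-- The product `∏_{i=0}^{j-1} [(1-q^{n-i-1})(1-t qⁱ)]/[(1-q^{1+i})(1-t q^{n-i-1})]`. -/
def macProdPos (n j : ℕ) : F :=
  ∏ i ∈ Finset.range j,
    ((1 - q ^ ((n : ℤ) - i - 1)) * (1 - t * q ^ (i : ℤ))) /
      ((1 - q ^ ((i : ℤ) + 1)) * (1 - t * q ^ ((n : ℤ) - i - 1)))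

/-- The product `∏_{i=0}^{j-1} [(1-q^{n-i})(1-t qⁱ)]/[(1-q^{1+i})(1-t q^{n-i})]`. -/
def macProdNeg (n j : ℕ) : F :=
  ∏ i ∈ Finset.range j,
    ((1 - q ^ ((n : ℤ) - i)) * (1 - t * q ^ (i : ℤ))) /
      ((1 - q ^ ((i : ℤ) + 1)) * (1 - t * q ^ ((n : ℤ) - i)))

/-- `E_n` for `n ≥ 1`. -/
def Epos (n : ℕ) : M :=
  XM ^ (n : ℤ)
    + ∑ j ∈ Finset.Icc 1 (n / 2),
        RatFunc.C (q ^ ((n : ℤ) - j) * (1 - q ^ (j : ℤ)) / (1 - q ^ ((n : ℤ) - j)) *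
          macProdPos n j) * XM ^ (2 * (j : ℤ) - n)
    + ∑ j ∈ Finset.Icc 1 ((n - 1) / 2),
        RatFunc.C (q ^ (j : ℤ) * macProdPos n j) * XM ^ ((n : ℤ) - 2 * j)

/-- `E_{-n}` for `n ≥ 1`. -/
def Eneg (n : ℕ) : M :=
  XM ^ (-(n : ℤ))
    + RatFunc.C ((1 - t) / (1 - t * q ^ (n : ℤ))) * XM ^ (n : ℤ)
    + ∑ j ∈ Finset.Icc 1 (n / 2),
        RatFunc.C (macProdNeg n j) * XM ^ (2 * (j : ℤ) - n)
    + ∑ j ∈ Finset.Icc 1 ((n - 1) / 2),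
        RatFunc.C ((1 - t * q ^ (j : ℤ)) / (1 - t * q ^ ((n : ℤ) - j)) * macProdNeg n j) *
          XM ^ ((n : ℤ) - 2 * j)

/-- The nonsymmetric Macdonald polynomials `E_n`, `n ∈ ℤ`, given by the explicit formulas. -/
def E : ℤ → M := fun n => if 0 < n then Epos n.toNat else if n = 0 then 1 else Eneg (-n).toNat

lemma q_zpow_ne_one (m : ℤ) (hm : m ≠ 0) : q ^ m ≠ 1 := by
  intro h
  have hX : (RatFunc.X : RatFunc ℚ) ≠ 0 := RatFunc.X_ne_zero
  have key : ∀ k : ℕ, k ≠ 0 → q ^ k ≠ 1 := by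
    intro k hk h
    have h2 : (RatFunc.X : RatFunc ℚ) ^ (4 * k) = 1 := by
      apply (RatFunc.C (K := RatFunc ℚ)).injective
      rw [map_pow, map_one, pow_mul]
      exact h
    have h3 : (Polynomial.X : Polynomial ℚ) ^ (4 * k) = 1 := by
      apply RatFunc.algebraMap_injective ℚ
      rw [map_pow, map_one, RatFunc.algebraMap_X]
      exact h2
    have h4 := congrArg Polynomial.natDegree h3
    simp at h4
    exact hk h4
  obtain ⟨k, rfl | rfl⟩ := m.eq_nat_or_neg
  · rw [zpow_natCast] at h
    exact key k (by simpa using hm) h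
  · rw [zpow_neg, zpow_natCast, inv_eq_one] at h
    exact key k (by simpa using hm) h

lemma u_ne_zero : u ≠ 0 := by
  unfold u
  rw [Ne, map_eq_zero]
  exact RatFunc.X_ne_zero

lemma v_ne_zero : v ≠ 0 := RatFunc.X_ne_zero

lemma q_ne_zero : q ≠ 0 := pow_ne_zero _ u_ne_zero

lemma sq_X_ne_C {K : Type*} [Field K] (c : K) : (RatFunc.X : RatFunc K) ^ 2 ≠ RatFunc.C c := by
  intro h
  have h3 : (Polynomial.X : Polynomial K) ^ 2 = Polynomial.C c := by
    apply RatFunc.algebraMap_injective K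
    rw [map_pow, RatFunc.algebraMap_X, RatFunc.algebraMap_C]
    exact h
  have h4 := congrArg Polynomial.natDegree h3
  simp at h4

lemma t_mul_ne_one (m : ℤ) : t * q ^ m ≠ 1 := by
  intro h
  have hq : q ^ m ≠ 0 := zpow_ne_zero _ q_ne_zero
  have h1 : t = (q ^ m)⁻¹ := eq_inv_of_mul_eq_one_left h
  apply sq_X_ne_C (((RatFunc.X : RatFunc ℚ) ^ 4) ^ m)⁻¹
  rw [map_inv₀, map_zpow₀, map_pow]
  exact h1

lemma one_sub_q_ne (m : ℤ) (hm : m ≠ 0) : 1 - q ^ m ≠ 0 :=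
  sub_ne_zero.2 (q_zpow_ne_one m hm).symm

lemma one_sub_tq_ne (m : ℤ) : 1 - t * q ^ m ≠ 0 :=
  sub_ne_zero.2 (t_mul_ne_one m).symm

lemma XM_ne_zero : XM ≠ 0 := RatFunc.X_ne_zero

lemma XM_sq_sub_one_ne : XM ^ 2 - 1 ≠ 0 := by
  have := sq_X_ne_C (1 : F)
  rw [map_one] at this
  exact sub_ne_zero.2 this

/-! ### Substitutions -/

lemma eval₂_ne_zero (c : F) (hc : c ≠ 0) (p : Polynomial F) (hp : p ≠ 0) :
    p.eval₂ RatFunc.C (RatFunc.C c * XM⁻¹) ≠ 0 := by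
  intro h
  have halg : IsAlgebraic F (RatFunc.C c * XM⁻¹) := ⟨p, hp, by
    rw [Polynomial.aeval_def, RatFunc.algebraMap_eq_C]; exact h⟩
  have h2 : IsAlgebraic F ((RatFunc.C c * XM⁻¹)⁻¹ * RatFunc.C c) := by
    refine IsAlgebraic.mul halg.inv ?_
    rw [← RatFunc.algebraMap_eq_C]
    exact isAlgebraic_algebraMap c
  have hc' : (RatFunc.C c : M) ≠ 0 := by rwa [Ne, map_eq_zero]
  have h3 : (RatFunc.C c * XM⁻¹)⁻¹ * RatFunc.C c = XM := by
    have := XM_ne_zero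
    field_simp
  rw [h3] at h2
  exact RatFunc.transcendental_X h2

/-- The substitution `X ↦ c X⁻¹` as a ring homomorphism. -/
def substHom (c : F) (hc : c ≠ 0) : M →+* M where
  toFun := RatFunc.eval RatFunc.C (RatFunc.C c * XM⁻¹)
  map_one' := RatFunc.eval_one _ _
  map_zero' := RatFunc.eval_zero _ _
  map_add' _ _ := RatFunc.eval_add _ _ (eval₂_ne_zero c hc _ (RatFunc.denom_ne_zero _))
    (eval₂_ne_zero c hc _ (RatFunc.denom_ne_zero _))
  map_mul' _ _ := RatFunc.eval_mul _ _ (eval₂_ne_zero c hc _ (RatFunc.denom_ne_zero _))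
    (eval₂_ne_zero c hc _ (RatFunc.denom_ne_zero _))

lemma field_mul_inv_zpow {K : Type*} [Field K] (x y : K) (m : ℤ) :
    (x * y⁻¹) ^ m = x ^ m * y ^ (-m) := by
  rw [mul_zpow, inv_zpow']

lemma field_zpow_add {K : Type*} [Field K] (x : K) (hx : x ≠ 0) (m k : ℤ) :
    x ^ (m + k) = x ^ m * x ^ k := zpow_add₀ hx m k

lemma XM_zpow_add (m k : ℤ) : XM ^ (m + k) = XM ^ m * XM ^ k :=
  field_zpow_add XM XM_ne_zero m k

lemma hom_zpow {K L : Type*} [Field K] [Field L] (φ : K →+* L) (x : K) (m : ℤ) :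
    φ (x ^ m) = φ x ^ m := map_zpow₀ φ x m

lemma substHom_term (c : F) (hc : c ≠ 0) (a : F) (m : ℤ) :
    substHom c hc (RatFunc.C a * XM ^ m) = RatFunc.C (a * c ^ m) * XM ^ (-m) := by
  have h1 : substHom c hc (RatFunc.C a) = RatFunc.C a := RatFunc.eval_C _ _
  have h2 : substHom c hc XM = RatFunc.C c * XM⁻¹ := RatFunc.eval_X _ _
  have h3 : substHom c hc (XM ^ m) = (substHom c hc XM) ^ m :=
    hom_zpow (substHom c hc) XM m
  have h4 : (RatFunc.C c * XM⁻¹) ^ m = RatFunc.C c ^ m * XM ^ (-m) :=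
    field_mul_inv_zpow (RatFunc.C c) XM m
  have h5 : (RatFunc.C (c ^ m) : M) = RatFunc.C c ^ m := hom_zpow RatFunc.C c m
  rw [map_mul, h3, h1, h2, h4, map_mul, h5, mul_assoc]

lemma piOp_sum (n : ℕ) (a : ℕ → F) (e : ℕ → ℤ) :
    piOp (∑ k ∈ Finset.range n, RatFunc.C (a k) * XM ^ e k) =
      ∑ k ∈ Finset.range n, RatFunc.C (a k * (u ^ 2) ^ e k) * XM ^ (-e k) := by
  have : piOp = substHom (u ^ 2) (pow_ne_zero _ u_ne_zero) := rfl
  rw [this, map_sum]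
  exact Finset.sum_congr rfl fun k _ => substHom_term _ _ _ _

lemma sOp_sum (n : ℕ) (a : ℕ → F) (e : ℕ → ℤ) :
    sOp (∑ k ∈ Finset.range n, RatFunc.C (a k) * XM ^ e k) =
      ∑ k ∈ Finset.range n, RatFunc.C (a k) * XM ^ (-e k) := by
  have : sOp = substHom 1 one_ne_zero := by
    unfold sOp
    have : XM⁻¹ = RatFunc.C 1 * XM⁻¹ := by rw [map_one, one_mul]
    rw [this]
    rfl
  rw [this, map_sum]
  refine Finset.sum_congr rfl fun k _ => ?_
  rw [substHom_term, one_zpow, mul_one]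

/-! ### Coefficients -/

lemma macProdPos_succ (n j : ℕ) : macProdPos n (j + 1) = macProdPos n j *
    (((1 - q ^ ((n : ℤ) - j - 1)) * (1 - t * q ^ (j : ℤ))) /
      ((1 - q ^ ((j : ℤ) + 1)) * (1 - t * q ^ ((n : ℤ) - j - 1)))) :=
  Finset.prod_range_succ _ _

lemma macProdNeg_succ (n j : ℕ) : macProdNeg n (j + 1) = macProdNeg n j *
    (((1 - q ^ ((n : ℤ) - j)) * (1 - t * q ^ (j : ℤ))) /
      ((1 - q ^ ((j : ℤ) + 1)) * (1 - t * q ^ ((n : ℤ) - j)))) :=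
  Finset.prod_range_succ _ _

lemma macProdPos_zero (n : ℕ) : macProdPos n 0 = 1 := Finset.prod_range_zero _

lemma macProdNeg_zero (n : ℕ) : macProdNeg n 0 = 1 := Finset.prod_range_zero _

lemma macProdPos_self (n : ℕ) (hn : 1 ≤ n) : macProdPos n n = 0 := by
  obtain ⟨m, rfl⟩ : ∃ m, n = m + 1 := ⟨n - 1, by omega⟩
  rw [macProdPos_succ]
  simp

lemma macProdPos_eq_neg (n j : ℕ) : macProdPos (n + 1) j = macProdNeg n j := by
  unfold macProdPos macProdNeg
  refine Finset.prod_congr rfl fun i _ => ?_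
  have : ((n + 1 : ℕ) : ℤ) - i - 1 = (n : ℤ) - i := by push_cast; ring
  rw [this]

lemma pos_step {K : Type*} [Field K] (P N A B D G J r : K) (h1 : 1 - A ≠ 0)
    (h2 : 1 - r * D ≠ 0) (h3 : 1 - r * B ≠ 0)
    (ih : P * ((1 - G) * (1 - r * D)) = N * ((1 - D) * (1 - r * G))) :
    P * (((1 - B) * (1 - r * J)) / ((1 - A) * (1 - r * B))) * ((1 - G) * (1 - r * B)) =
      N * (((1 - D) * (1 - r * J)) / ((1 - A) * (1 - r * D))) * ((1 - B) * (1 - r * G)) := by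
  have e : P * (((1 - B) * (1 - r * J)) / ((1 - A) * (1 - r * B))) * ((1 - G) * (1 - r * B)) =
      P * ((1 - G) * (1 - r * D)) * ((1 - B) * (1 - r * J)) / ((1 - A) * (1 - r * D)) := by
    rw [← mul_div_assoc, div_mul_eq_mul_div,
      div_eq_div_iff (mul_ne_zero h1 h3) (mul_ne_zero h1 h2)]
    ring
  rw [e, ih]
  ring

lemma pos_mul (n j : ℕ) :
    macProdPos n j * ((1 - q ^ (n : ℤ)) * (1 - t * q ^ ((n : ℤ) - j))) =
      macProdNeg n j * ((1 - q ^ ((n : ℤ) - j)) * (1 - t * q ^ (n : ℤ))) := by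
  induction j with
  | zero => simp [macProdPos_zero, macProdNeg_zero]
  | succ j ih =>
    rw [macProdPos_succ, macProdNeg_succ]
    have e : (n : ℤ) - ((j + 1 : ℕ) : ℤ) = (n : ℤ) - j - 1 := by push_cast; ring
    rw [e]
    have h1 := one_sub_q_ne ((j : ℤ) + 1) (by omega)
    have h2 := one_sub_tq_ne ((n : ℤ) - j)
    have h3 := one_sub_tq_ne ((n : ℤ) - j - 1)
    exact pos_step _ _ _ _ _ _ _ _ h1 h2 h3 ih

/-- `(q;q)_m`. -/
def qPoch (m : ℕ) : F := ∏ i ∈ Finset.range m, (1 - q ^ ((i : ℤ) + 1))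

/-- `(t;q)_m`. -/
def tPoch (m : ℕ) : F := ∏ i ∈ Finset.range m, (1 - t * q ^ (i : ℤ))

lemma qPoch_succ (m : ℕ) : qPoch (m + 1) = qPoch m * (1 - q ^ ((m : ℤ) + 1)) :=
  Finset.prod_range_succ _ _

lemma tPoch_succ (m : ℕ) : tPoch (m + 1) = tPoch m * (1 - t * q ^ (m : ℤ)) :=
  Finset.prod_range_succ _ _

lemma qPoch_ne (m : ℕ) : qPoch m ≠ 0 :=
  Finset.prod_ne_zero_iff.2 fun i _ => one_sub_q_ne _ (by omega)

lemma tPoch_ne (m : ℕ) : tPoch m ≠ 0 :=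
  Finset.prod_ne_zero_iff.2 fun i _ => one_sub_tq_ne _

lemma neg_closed (j : ℕ) : ∀ i : ℕ, macProdNeg (i + j) j =
    qPoch (i + j) * tPoch j * tPoch (i + 1) / (qPoch j * qPoch i * tPoch (i + j + 1)) := by
  induction j with
  | zero =>
    intro i
    have := qPoch_ne i
    have := tPoch_ne (i + 1)
    simp only [macProdNeg_zero, add_zero]
    have h0 : qPoch 0 = 1 := Finset.prod_range_zero _
    have h1 : tPoch 0 = 1 := Finset.prod_range_zero _
    rw [h0, h1]
    field_simp
  | succ j ih =>
    intro i
    have e : i + (j + 1) = (i + 1) + j := by ring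
    rw [macProdNeg_succ, e, ih (i + 1)]
    have e2 : ((i + 1 + j : ℕ) : ℤ) - j = (i : ℤ) + 1 := by push_cast; ring
    rw [e2, tPoch_succ (i + 1), tPoch_succ j, qPoch_succ j, qPoch_succ i]
    have e3 : ((i + 1 : ℕ) : ℤ) = (i : ℤ) + 1 := by push_cast; ring
    rw [e3]
    have h1 := one_sub_q_ne ((j : ℤ) + 1) (by omega)
    have h2 := one_sub_q_ne ((i : ℤ) + 1) (by omega)
    have h3 := one_sub_tq_ne ((i : ℤ) + 1)
    have h4 := qPoch_ne i
    have h5 := qPoch_ne j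
    have h6 := tPoch_ne (i + 1 + j + 1)
    generalize q ^ ((j : ℤ) + 1) = A at *
    generalize q ^ ((i : ℤ) + 1) = B at *
    field_simp

lemma neg_reflect (n j : ℕ) (hj : j ≤ n) :
    macProdNeg n (n - j) =
      (1 - t * q ^ (j : ℤ)) / (1 - t * q ^ ((n : ℤ) - j)) * macProdNeg n j := by
  obtain ⟨i, rfl⟩ : ∃ i, n = i + j := ⟨n - j, by omega⟩
  have e : i + j - j = i := by omega
  have e2 : ((i + j : ℕ) : ℤ) - j = i := by push_cast; ring
  rw [e, e2, neg_closed j i]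
  have e3 : macProdNeg (i + j) i = macProdNeg (j + i) i := by rw [add_comm]
  rw [e3, neg_closed i j, add_comm j i, tPoch_succ i, tPoch_succ j]
  have h3 := one_sub_tq_ne (i : ℤ)
  have h4 := qPoch_ne i
  have h5 := qPoch_ne j
  have h6 := tPoch_ne (i + j + 1)
  field_simp

lemma pos_eq (n j : ℕ) (hn : 1 ≤ n) : macProdPos n j =
    macProdNeg n j * ((1 - q ^ ((n : ℤ) - j)) * (1 - t * q ^ (n : ℤ))) /
      ((1 - q ^ (n : ℤ)) * (1 - t * q ^ ((n : ℤ) - j))) := by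
  rw [eq_div_iff (mul_ne_zero (one_sub_q_ne _ (by omega)) (one_sub_tq_ne _))]
  exact pos_mul n j

lemma pos_reflect_eq (n j : ℕ) (hn : 1 ≤ n) (hj : j ≤ n) : macProdPos n (n - j) =
    macProdNeg n j * ((1 - q ^ (j : ℤ)) * (1 - t * q ^ (n : ℤ))) /
      ((1 - q ^ (n : ℤ)) * (1 - t * q ^ ((n : ℤ) - j))) := by
  rw [pos_eq n (n - j) hn, neg_reflect n j hj]
  have e : (n : ℤ) - ((n - j : ℕ) : ℤ) = j := by omega
  rw [e]
  have h1 := one_sub_q_ne (n : ℤ) (by omega)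
  have h2 := one_sub_tq_ne (j : ℤ)
  have h3 := one_sub_tq_ne ((n : ℤ) - j)
  generalize q ^ ((n : ℤ) - j) = B at *
  field_simp

lemma sum_split {A : Type*} [AddCommMonoid A] (n : ℕ) (hn : 1 ≤ n) (f : ℕ → A) :
    ∑ k ∈ Finset.range (n + 1), f k =
      f 0 + f n + ∑ j ∈ Finset.Icc 1 (n / 2), f (n - j)
        + ∑ j ∈ Finset.Icc 1 ((n - 1) / 2), f j := by
  have h1 : ∀ m : ℕ, ∀ g : ℕ → A,
      ∑ j ∈ Finset.range (m + 1), g j = g 0 + ∑ j ∈ Finset.Icc 1 m, g j := by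
    intro m g
    rw [Finset.range_eq_Ico, Finset.sum_eq_sum_Ico_succ_bot (by omega)]
    rfl
  have h2 : n + 1 = ((n - 1) / 2 + 1) + (n / 2 + 1) := by omega
  rw [h2, Finset.sum_range_add, ← Finset.sum_range_reflect _ (n / 2 + 1), h1, h1]
  have h3 : ∀ j ∈ Finset.Icc 1 (n / 2),
      f ((n - 1) / 2 + 1 + (n / 2 + 1 - 1 - j)) = f (n - j) := by
    intro j hj
    rw [Finset.mem_Icc] at hj
    congr 1
    omega
  rw [Finset.sum_congr rfl h3]
  have h4 : (n - 1) / 2 + 1 + (n / 2 + 1 - 1 - 0) = n := by omega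
  rw [h4]
  abel

lemma Epos_eq (n : ℕ) (hn : 1 ≤ n) : Epos n =
    ∑ k ∈ Finset.range (n + 1),
      RatFunc.C (q ^ (k : ℤ) * macProdPos n k) * XM ^ ((n : ℤ) - 2 * k) := by
  rw [sum_split n hn]
  unfold Epos
  congr 1
  congr 1
  · simp [macProdPos_zero, macProdPos_self n hn]
  · refine Finset.sum_congr rfl fun j hj => ?_
    rw [Finset.mem_Icc] at hj
    have e1 : ((n - j : ℕ) : ℤ) = (n : ℤ) - j := by omega
    rw [e1]
    have e2 : (n : ℤ) - 2 * ((n : ℤ) - j) = 2 * j - n := by ring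
    rw [e2, pos_reflect_eq n j hn (by omega), pos_eq n j hn]
    have h1 := one_sub_q_ne (n : ℤ) (by omega)
    have h2 := one_sub_tq_ne ((n : ℤ) - j)
    have h3 := one_sub_q_ne ((n : ℤ) - j) (by omega)
    congr 2
    generalize q ^ ((n : ℤ) - j) = B at *
    field_simp

lemma Eneg_eq (n : ℕ) (hn : 1 ≤ n) : Eneg n =
    ∑ k ∈ Finset.range (n + 1),
      RatFunc.C (macProdNeg n k) * XM ^ (2 * (k : ℤ) - n) := by
  rw [← Finset.sum_range_reflect, sum_split n hn]
  have hr : ∀ j, j ≤ n → n + 1 - 1 - j = n - j := by intro j hj; omega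
  have a0 : RatFunc.C (macProdNeg n (n + 1 - 1 - 0)) * XM ^ (2 * ((n + 1 - 1 - 0 : ℕ) : ℤ) - n) =
      RatFunc.C ((1 - t) / (1 - t * q ^ (n : ℤ))) * XM ^ (n : ℤ) := by
    rw [hr 0 (by omega), neg_reflect n 0 (by omega), macProdNeg_zero]
    have e1 : 2 * ((n - 0 : ℕ) : ℤ) - n = n := by omega
    rw [e1]
    simp
  have an : RatFunc.C (macProdNeg n (n + 1 - 1 - n)) * XM ^ (2 * ((n + 1 - 1 - n : ℕ) : ℤ) - n) =
      XM ^ (-(n : ℤ)) := by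
    simp [macProdNeg_zero]
  rw [a0, an]
  unfold Eneg
  congr 1
  · congr 1
    · exact add_comm _ _
    · refine Finset.sum_congr rfl fun j hj => ?_
      rw [Finset.mem_Icc] at hj
      rw [hr _ (by omega)]
      have : n - (n - j) = j := by omega
      rw [this]
  · refine Finset.sum_congr rfl fun j hj => ?_
    rw [Finset.mem_Icc] at hj
    rw [hr j (by omega), neg_reflect n j (by omega)]
    congr 2
    omega

lemma E_natCast (n : ℕ) (hn : 1 ≤ n) : E (n : ℤ) =
    ∑ k ∈ Finset.range (n + 1),
      RatFunc.C (q ^ (k : ℤ) * macProdPos n k) * XM ^ ((n : ℤ) - 2 * k) := by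
  rw [← Epos_eq n hn]
  unfold E
  rw [if_pos (by omega), Int.toNat_natCast]

lemma E_neg_natCast (n : ℕ) : E (-(n : ℤ)) =
    ∑ k ∈ Finset.range (n + 1),
      RatFunc.C (macProdNeg n k) * XM ^ (2 * (k : ℤ) - n) := by
  unfold E
  rw [if_neg (by omega)]
  rcases Nat.eq_zero_or_pos n with rfl | hn
  · simp [macProdNeg_zero]
  · rw [if_neg (by omega), neg_neg, Int.toNat_natCast, Eneg_eq n hn]

/-- The coefficient of `X^{2k+2-n}` contributed by the `k`-th term. -/
def alphaCoef (n k : ℕ) : F := macProdNeg n k - t * (q ^ (k : ℤ) * macProdPos n k)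
  - (1 - t) / (1 - t * q ^ (n : ℤ)) * (q ^ ((n : ℤ) - k) * macProdPos n (n - k))

/-- Minus the coefficient of `X^{2k-n}` contributed by the `k`-th term. -/
def betaCoef (n k : ℕ) : F := macProdNeg n k - q ^ (k : ℤ) * macProdPos n k
  - (1 - t) / (1 - t * q ^ (n : ℤ)) * (t * q ^ (n : ℤ)) *
    (q ^ ((n : ℤ) - k) * macProdPos n (n - k))

lemma beta_zero (n : ℕ) (hn : 1 ≤ n) : betaCoef n 0 = 0 := by
  simp [betaCoef, macProdNeg_zero, macProdPos_zero, macProdPos_self n hn]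

lemma alpha_self (n : ℕ) (hn : 1 ≤ n) : alphaCoef n n = 0 := by
  have := neg_reflect n 0 (by omega)
  simp only [Nat.sub_zero] at this
  simp [alphaCoef, this, macProdNeg_zero, macProdPos_zero, macProdPos_self n hn]

lemma alpha_beta_aux {K : Type*} [Field K] (N r R Q p : K)
    (h1 : 1 - R * p * Q ≠ 0) (h2 : 1 - r * (R * p * Q) ≠ 0) (h3 : 1 - r * (R * p) ≠ 0)
    (h4 : 1 - r * R ≠ 0) (h5 : 1 - Q * p ≠ 0) : 
    N - r * (Q * (N * ((1 - R * p) * (1 - r * (R * p * Q))) / ((1 - R * p * Q) * (1 - r * (R * p))))) -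
      (1 - r) / (1 - r * (R * p * Q)) * (R * p * (N * ((1 - Q) * (1 - r * (R * p * Q))) / ((1 - R * p * Q) * (1 - r * (R * p))))) =
    N * (((1 - R * p) * (1 - r * Q)) / ((1 - Q * p) * (1 - r * (R * p)))) -
      Q * p * (N * (((1 - R * p) * (1 - r * Q)) / ((1 - Q * p) * (1 - r * (R * p)))) * ((1 - R) * (1 - r * (R * p * Q))) / ((1 - R * p * Q) * (1 - r * R))) -
      (1 - r) / (1 - r * (R * p * Q)) * (r * (R * p * Q)) *
        (R * (N * (((1 - R * p) * (1 - r * Q)) / ((1 - Q * p) * (1 - r * (R * p)))) * ((1 - Q * p) * (1 - r * (R * p * Q))) / ((1 - R * p * Q) * (1 - r * R)))) := by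
  generalize g1 : 1 - R * p * Q = d1 at *
  generalize g2 : 1 - r * (R * p * Q) = d2 at *
  generalize g3 : 1 - r * (R * p) = d3 at *
  generalize g4 : 1 - r * R = d4 at *
  generalize g5 : 1 - Q * p = d5 at *
  field_simp
  subst g1 g2 g3 g4 g5
  ring

lemma alpha_eq_beta (n k : ℕ) (hk : k < n) : alphaCoef n k = betaCoef n (k + 1) := by
  have hn : 1 ≤ n := by omega
  unfold alphaCoef betaCoef
  rw [pos_reflect_eq n k hn (by omega), pos_reflect_eq n (k + 1) hn (by omega), pos_eq n k hn,
    pos_eq n (k + 1) hn, macProdNeg_succ]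
  obtain ⟨i, rfl⟩ : ∃ i, n = i + 1 + k := ⟨n - k - 1, by omega⟩
  have e1 : ((i + 1 + k : ℕ) : ℤ) - k = ((i + 1 : ℕ) : ℤ) := by push_cast; ring
  have e2 : ((i + 1 + k : ℕ) : ℤ) - ((k + 1 : ℕ) : ℤ) = (i : ℤ) := by push_cast; ring
  have e3 : (k : ℤ) + 1 = ((k + 1 : ℕ) : ℤ) := by push_cast; ring
  rw [e1, e2, e3]
  have h1 := one_sub_q_ne ((i + 1 + k : ℕ) : ℤ) (by omega)
  have h2 := one_sub_tq_ne ((i + 1 + k : ℕ) : ℤ)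
  have h3 := one_sub_tq_ne ((i + 1 : ℕ) : ℤ)
  have h4 := one_sub_tq_ne (i : ℤ)
  have h5 := one_sub_q_ne ((k + 1 : ℕ) : ℤ) (by omega)
  simp only [zpow_natCast] at *
  have p1 : q ^ (i + 1 + k) = q ^ i * q * q ^ k := by ring
  have p2 : q ^ (i + 1) = q ^ i * q := by ring
  have p3 : q ^ (k + 1) = q ^ k * q := by ring
  rw [p1] at h1 h2 ⊢
  rw [p2] at h3 ⊢
  rw [p3] at h5 ⊢
  exact alpha_beta_aux _ _ _ _ _ h1 h2 h3 h4 h5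

lemma telescope (n : ℕ) (hn : 1 ≤ n) :
    ∑ k ∈ Finset.range (n + 1),
      (RatFunc.C (alphaCoef n k) * XM ^ 2 - RatFunc.C (betaCoef n k)) * XM ^ (2 * (k : ℤ) - n)
      = 0 := by
  have h : ∀ k ∈ Finset.range (n + 1),
      (RatFunc.C (alphaCoef n k) * XM ^ 2 - RatFunc.C (betaCoef n k)) * XM ^ (2 * (k : ℤ) - n)
      = RatFunc.C (alphaCoef n k) * XM ^ (2 * ((k + 1 : ℕ) : ℤ) - n)
        - RatFunc.C (betaCoef n k) * XM ^ (2 * (k : ℤ) - n) := by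
    intro k _
    have : (2 * ((k + 1 : ℕ) : ℤ) - n) = 2 + (2 * (k : ℤ) - n) := by push_cast; ring
    have h2 : XM ^ (2 : ℤ) = XM ^ 2 := by norm_cast
    rw [this, XM_zpow_add, h2]
    ring
  rw [Finset.sum_congr rfl h, Finset.sum_sub_distrib, Finset.sum_range_succ,
    Finset.sum_range_succ' _ n, beta_zero n hn, alpha_self n hn]
  rw [map_zero, zero_mul, zero_mul, add_zero, add_zero, sub_eq_zero]
  refine Finset.sum_congr rfl fun k hk => ?_
  rw [alpha_eq_beta n k (Finset.mem_range.1 hk)]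

lemma final_aux {K : Type*} [Field K] (w Q X S e e' : K) (hX : X ^ 2 - 1 ≠ 0) (hv : w ≠ 0)
    (hd : 1 - w ^ 2 * Q ≠ 0)
    (key : (X ^ 2 - 1) * e' - (w ^ 2 * X ^ 2 - 1) * S
      - (1 - w ^ 2) / (1 - w ^ 2 * Q) * (X ^ 2 - w ^ 2 * Q) * e = 0) :
    e' = w * (w * S + (w - w⁻¹) * (S - e) / (X ^ 2 - 1) + (w - w⁻¹) / (Q * w ^ 2 - 1) * e) := by
  have hd' : Q * w ^ 2 - 1 = -(1 - w ^ 2 * Q) := by ring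
  have hw : w - w⁻¹ = -(1 - w ^ 2) / w := by field_simp; ring
  rw [hd', hw]
  have hQ : w ^ 2 * Q = 1 - (1 - w ^ 2 * Q) := by ring
  generalize 1 - w ^ 2 * Q = d at *
  rw [hQ] at key
  generalize g : X ^ 2 - 1 = x at *
  have hx : X ^ 2 = x + 1 := by rw [← g]; ring
  rw [hx] at key
  field_simp at key ⊢
  linear_combination key

/-- The intertwining operators generate the whole family of nonsymmetric Macdonald
polynomials: for every `n ≥ 0`, `E_{n+1} = q^{n/2}·X·π(E_{-n})`, and for every `n ≥ 1`,
`E_{-n} = t^{1/2}·(T(E_n) + ((t^{1/2} - t^{-1/2})/(qⁿ·t - 1))·E_n)`. -/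
theorem macdonald_intertwiners :
    (∀ n : ℕ, E ((n : ℤ) + 1) = RatFunc.C ((u ^ 2) ^ (n : ℤ)) * (XM * piOp (E (-(n : ℤ))))) ∧
    (∀ n : ℕ, 1 ≤ n →
      E (-(n : ℤ)) = RatFunc.C v *
        (TOp (E (n : ℤ)) + RatFunc.C ((v - v⁻¹) / (q ^ (n : ℤ) * t - 1)) * E (n : ℤ))) := by
  constructor
  · intro n
    have h := E_natCast (n + 1) (by omega)
    rw [Nat.cast_add, Nat.cast_one] at h
    rw [h, E_neg_natCast, piOp_sum, Finset.sum_range_succ, macProdPos_self _ (by omega), mul_zero,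
      map_zero, zero_mul, add_zero, Finset.mul_sum, Finset.mul_sum]
    refine Finset.sum_congr rfl fun k _ => ?_
    have e1 : (n : ℤ) + 1 - 2 * k = 1 + -(2 * (k : ℤ) - n) := by ring
    rw [e1, XM_zpow_add, zpow_one, macProdPos_eq_neg]
    have e2 : q ^ (k : ℤ) = (u ^ 2) ^ (n : ℤ) * (u ^ 2) ^ (2 * (k : ℤ) - n) := by
      rw [← zpow_add₀ (pow_ne_zero _ u_ne_zero)]
      have : (n : ℤ) + (2 * (k : ℤ) - n) = 2 * k := by ring
      rw [this, zpow_mul, q, zpow_ofNat]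
      ring
    rw [e2]
    simp only [map_mul]
    ring
  · intro n hn
    have hs : sOp (E (n : ℤ)) = ∑ k ∈ Finset.range (n + 1),
        RatFunc.C (q ^ (k : ℤ) * macProdPos n k) * XM ^ (2 * (k : ℤ) - n) := by
      rw [E_natCast n hn, sOp_sum]
      refine Finset.sum_congr rfl fun k _ => ?_
      rw [neg_sub]
    have hE : E (n : ℤ) = ∑ k ∈ Finset.range (n + 1),
        RatFunc.C (q ^ ((n : ℤ) - k) * macProdPos n (n - k)) * XM ^ (2 * (k : ℤ) - n) := by
      rw [E_natCast n hn, ← Finset.sum_range_reflect]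
      refine Finset.sum_congr rfl fun k hk => ?_
      rw [Finset.mem_range] at hk
      have e1 : n + 1 - 1 - k = n - k := by omega
      have e2 : ((n - k : ℕ) : ℤ) = (n : ℤ) - k := by omega
      rw [e1, e2]
      congr 2
      ring
    have key : (XM ^ 2 - 1) * E (-(n : ℤ)) - (RatFunc.C t * XM ^ 2 - 1) * sOp (E (n : ℤ))
        - RatFunc.C ((1 - t) / (1 - t * q ^ (n : ℤ))) * (XM ^ 2 - RatFunc.C (t * q ^ (n : ℤ)))
          * E (n : ℤ) = 0 := by
      rw [hs, hE, E_neg_natCast, ← telescope n hn, Finset.mul_sum, Finset.mul_sum, Finset.mul_sum,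
        ← Finset.sum_sub_distrib, ← Finset.sum_sub_distrib]
      refine Finset.sum_congr rfl fun k _ => ?_
      simp only [alphaCoef, betaCoef, map_sub, map_mul]
      ring
    unfold TOp
    generalize sOp (E (n : ℤ)) = S at *
    generalize E (n : ℤ) = e at *
    generalize E (-(n : ℤ)) = e' at *
    have hX := XM_sq_sub_one_ne
    have hv : (RatFunc.C v : M) ≠ 0 := by rw [Ne, map_eq_zero]; exact v_ne_zero
    have ht : (RatFunc.C t : M) = RatFunc.C v ^ 2 := by rw [t, map_pow]
    have hd : (1 : M) - RatFunc.C t * RatFunc.C (q ^ (n : ℤ)) ≠ 0 := by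
      have := one_sub_tq_ne (n : ℤ)
      rw [← map_mul, ← map_one (RatFunc.C (K := F)), ← map_sub, Ne, map_eq_zero]
      exact this
    simp only [map_sub, map_mul, map_div₀, map_one, map_inv₀] at key ⊢
    rw [ht] at key hd ⊢
    exact final_aux _ _ _ _ _ _ hX hv hd key
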